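/- Chain rule for Φ-entropy: Let (X, π) be a weighted simplicial complex of rank n, Φ : ℝ≥0 → ℝ≥0 convex, and 0 ≤ ℓ ≤ r ≤ n. For every f : X^(r) → ℝ≥0, Ent^Φ_{π_r}(f) = E_{ω̂ ∼ π_ℓ}[ Ent^Φ_{π^(ω̂)_{r−ℓ}}(f|_ω̂) ] + Ent^Φ_{π_ℓ}(Up_{ℓ→r} f), where f|_ω̂ is the localization of f at ω̂. -/

import Mathlib

open scoped Classical
noncomputable section

namespace Expanderized

/-! ## Generic weighted linear algebra over finite types -/

section Generic

variable {α β γ : Type*}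

/-- Inner product `⟨f,g⟩_μ = E_{x∼μ}[f(x)g(x)]` with respect to a weight `μ`. -/
def inner' [Fintype α] (μ : α → ℝ) (f g : α → ℝ) : ℝ := ∑ x, μ x * (f x * g x)

/-- Expectation with respect to `μ`. -/
def expect [Fintype α] (μ : α → ℝ) (f : α → ℝ) : ℝ := ∑ x, μ x * f x

/-- `μ` is a probability distribution. -/
def IsProbDist [Fintype α] (μ : α → ℝ) : Prop := (∀ x, 0 ≤ μ x) ∧ (∑ x, μ x) = 1

/-- A row-stochastic kernel. -/
def IsRowStochastic [Fintype β] (P : α → β → ℝ) : Prop :=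
  (∀ x y, 0 ≤ P x y) ∧ ∀ x, (∑ y, P x y) = 1

/-- Product of two kernels (matrix multiplication). -/
def matMul [Fintype β] (A : α → β → ℝ) (B : β → γ → ℝ) : α → γ → ℝ :=
  fun x z => ∑ y, A x y * B y z

/-- Right action of a kernel on a function (column vector). -/
def mApp [Fintype β] (A : α → β → ℝ) (f : β → ℝ) : α → ℝ :=
  fun x => ∑ y, A x y * f y

/-- Left action of a kernel on a row vector / measure. -/
def rowMul [Fintype α] (μ : α → ℝ) (A : α → β → ℝ) : β → ℝ :=
  fun y => ∑ x, μ x * A x y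

/-- The adjoint of the kernel `P` with respect to the measures `(μ₁, μ₂)`. -/
def adjointKer [Fintype α] [Fintype β] (μ₁ : α → ℝ) (μ₂ : β → ℝ) (P : α → β → ℝ) :
    β → α → ℝ :=
  fun y x => P x y * μ₁ x / μ₂ y

/-- Iterates of a square kernel. -/
def matIter [Fintype α] [DecidableEq α] (A : α → α → ℝ) : ℕ → (α → α → ℝ)
  | 0 => fun x y => if x = y then 1 else 0
  | (t + 1) => matMul (matIter A t) A

/-- The second-largest eigenvalue `λ₂` of a random walk matrix that is reversible
with respect to `μ`, via its Rayleigh-quotient (Courant–Fischer) characterization. -/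
def lambda2 [Fintype α] (μ : α → ℝ) (A : α → α → ℝ) : ℝ :=
  sSup {r | ∃ f : α → ℝ, inner' μ f f = 1 ∧ inner' μ f (fun _ => 1) = 0 ∧
      r = inner' μ f (mApp A f)}

/-- The spectral gap `1 - λ₂`. -/
def specGap [Fintype α] (μ : α → ℝ) (A : α → α → ℝ) : ℝ := 1 - lambda2 μ A

/-- The two-sided expansion `λ(A) = max(λ₂(A), |λ_min(A)|)` of a random walk matrix
reversible with respect to `μ`, via its Rayleigh-quotient characterization. -/
def twoSided [Fintype α] (μ : α → ℝ) (A : α → α → ℝ) : ℝ :=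
  sSup {r | ∃ f : α → ℝ, inner' μ f f = 1 ∧ inner' μ f (fun _ => 1) = 0 ∧
      r = |inner' μ f (mApp A f)|}

/-- The operator norm `‖A‖_{op,μ}`. -/
def opNorm [Fintype α] (μ : α → ℝ) (A : α → α → ℝ) : ℝ :=
  sSup {r | ∃ f : α → ℝ, inner' μ f f = 1 ∧
      r = Real.sqrt (inner' μ (mApp A f) (mApp A f))}

/-- The `Φ`-entropy functional `Ent^Φ_μ(f) = E_μ[Φ(f)] - Φ(E_μ f)`. -/
def phiEnt [Fintype α] (Φ : ℝ → ℝ) (μ : α → ℝ) (f : α → ℝ) : ℝ :=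
  expect μ (fun x => Φ (f x)) - Φ (expect μ f)

/-- `t ↦ t log t`; note `Real.log 0 = 0`, so the convention `0 log 0 = 0` is built in. -/
def nlog (t : ℝ) : ℝ := t * Real.log t

/-- The usual entropy functional `Ent_μ`. -/
def ent [Fintype α] (μ : α → ℝ) (f : α → ℝ) : ℝ := phiEnt nlog μ f

/-- The `Φ`-entropy contraction constant of a kernel `P` with respect to measures
`(μ₁, μ₂)`: the largest `C ≥ 0` such that `Ent^Φ_{μ₁}(Pf) ≤ (1-C)·Ent^Φ_{μ₂}(f)`
for all nonnegative `f`. -/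
def CFphi [Fintype α] [Fintype β] (Φ : ℝ → ℝ) (μ₁ : α → ℝ) (μ₂ : β → ℝ)
    (P : α → β → ℝ) : ℝ :=
  sSup {C | 0 ≤ C ∧ ∀ f : β → ℝ, (∀ y, 0 ≤ f y) →
      phiEnt Φ μ₁ (mApp P f) ≤ (1 - C) * phiEnt Φ μ₂ f}

/-- The entropy contraction constant `EC(P)`. -/
def EC [Fintype α] [Fintype β] (μ₁ : α → ℝ) (μ₂ : β → ℝ) (P : α → β → ℝ) : ℝ :=
  CFphi nlog μ₁ μ₂ P

/-- The log-Sobolev constant of a reversible kernel `P` with stationary measure `μ`: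
the largest `C ≥ 0` with `C·Ent_μ(f²) ≤ ⟨f,(I-P)f⟩_μ` for all nonnegative `f`. -/
def LS [Fintype α] (μ : α → ℝ) (P : α → α → ℝ) : ℝ :=
  sSup {C | 0 ≤ C ∧ ∀ f : α → ℝ, (∀ x, 0 ≤ f x) →
      C * ent μ (fun x => f x ^ 2) ≤ inner' μ f (fun x => f x - mApp P f x)}

/-- The modified log-Sobolev constant of a reversible kernel `P` with stationary
measure `μ`: the largest `C ≥ 0` with `C·Ent_μ(f) ≤ ⟨f,(I-P) log f⟩_μ`
for all strictly positive `f`. -/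
def MLS [Fintype α] (μ : α → ℝ) (P : α → α → ℝ) : ℝ :=
  sSup {C | 0 ≤ C ∧ ∀ f : α → ℝ, (∀ x, 0 < f x) →
      C * ent μ f ≤
        inner' μ f (fun x => Real.log (f x) - mApp P (fun y => Real.log (f y)) x)}

/-- Total variation distance. -/
def tvDist [Fintype α] (μ ν : α → ℝ) : ℝ := (∑ x, |μ x - ν x|) / 2

/-- The `ε`-mixing time of a kernel `P` towards the target distribution `π`. -/
def mixingTime [Fintype α] [DecidableEq α] (P : α → α → ℝ) (π : α → ℝ) (ε : ℝ) : ℕ :=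
  sInf {t : ℕ | ∀ μ₀ : α → ℝ, IsProbDist μ₀ → tvDist (rowMul μ₀ (matIter P t)) π ≤ ε}

end Generic

/-! ## Weighted simplicial complexes -/

/-- A weighted (pure) simplicial complex of rank `n` on a finite vertex set `V`:
a downward-closed collection of faces, all maximal faces of cardinality `n`,
together with a fully supported probability distribution `pi` on the rank `n` faces
(extended by zero to all finsets). -/
structure WComplex (V : Type*) [Fintype V] [DecidableEq V] (n : ℕ) where
  faces : Finset (Finset V)
  pi : Finset V → ℝ
  faces_nonempty : faces.Nonempty
  down_closed : ∀ α ∈ faces, ∀ β ⊆ α, β ∈ faces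
  card_le : ∀ α ∈ faces, α.card ≤ n
  pure : ∀ α ∈ faces, ∃ ω ∈ faces, ω.card = n ∧ α ⊆ ω
  pi_pos : ∀ ω ∈ faces, ω.card = n → 0 < pi ω
  pi_zero_of_not_mem : ∀ ω : Finset V, ω ∉ faces → pi ω = 0
  pi_zero_of_card_ne : ∀ ω : Finset V, ω.card ≠ n → pi ω = 0
  pi_sum : (∑ ω : Finset V, pi ω) = 1

namespace WComplex

variable {V : Type*} [Fintype V] [DecidableEq V] {n : ℕ}

/-- `Pr_{ω∼π}[ω ⊇ α]` (unnormalized level mass of a face). -/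
def mass (K : WComplex V n) (α : Finset V) : ℝ :=
  ∑ ω : Finset V, if α ⊆ ω then K.pi ω else 0

/-- The induced distribution `π_j` on the `j`-th level `X^(j)`. -/
def level (K : WComplex V n) (j : ℕ) : Finset V → ℝ :=
  fun α => if α.card = j then ((n.choose j : ℝ))⁻¹ * K.mass α else 0

/-- The up-walk `Up_{ℓ→k}`. -/
def up (K : WComplex V n) (ℓ k : ℕ) : Finset V → Finset V → ℝ :=
  fun a b =>
    if a.card = ℓ ∧ b.card = k ∧ a ⊆ b then
      (((n - ℓ).choose (k - ℓ) : ℝ))⁻¹ * (K.mass b / K.mass a)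
    else 0

/-- The down-walk `Down_{k→ℓ}`. -/
def down (K : WComplex V n) (k ℓ : ℕ) : Finset V → Finset V → ℝ :=
  fun a b => if a.card = k ∧ b.card = ℓ ∧ b ⊆ a then ((k.choose ℓ : ℝ))⁻¹ else 0

/-- The down-up walk `Duw_{n↔ℓ} = Down_{n→ℓ}·Up_{ℓ→n}` on `X^(n)`. -/
def downUp (K : WComplex V n) (ℓ : ℕ) : Finset V → Finset V → ℝ :=
  matMul (K.down n ℓ) (K.up ℓ n)

/-- The up-down walk `Udw_{ℓ↔n} = Up_{ℓ→n}·Down_{n→ℓ}` on `X^(ℓ)`. -/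
def upDown (K : WComplex V n) (ℓ : ℕ) : Finset V → Finset V → ℝ :=
  matMul (K.up ℓ n) (K.down n ℓ)

/-- The top-level distribution `π^(ω̂)` of the link complex of the face `z`. -/
def linkPi (K : WComplex V n) (z : Finset V) : Finset V → ℝ :=
  fun α => if Disjoint α z then K.pi (z ∪ α) / K.mass z else 0

/-- Unnormalized level mass in the link of `z`. -/
def linkMass (K : WComplex V n) (z α : Finset V) : ℝ :=
  ∑ β : Finset V, if α ⊆ β then K.linkPi z β else 0

/-- The induced distribution `π^(ω̂)_j` on the `j`-th level of the link of `z`. -/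
def linkLevel (K : WComplex V n) (z : Finset V) (j : ℕ) : Finset V → ℝ :=
  fun α => if α.card = j then (((n - z.card).choose j : ℝ))⁻¹ * K.linkMass z α else 0

/-- The up-walk `Up^{ω̂}_{ℓ→k}` of the link complex of `z`. -/
def linkUp (K : WComplex V n) (z : Finset V) (ℓ k : ℕ) : Finset V → Finset V → ℝ :=
  fun a b =>
    if a.card = ℓ ∧ b.card = k ∧ a ⊆ b then
      ((((n - z.card) - ℓ).choose (k - ℓ) : ℝ))⁻¹ * (K.linkMass z b / K.linkMass z a)
    else 0

/-- The vertex marginal `π^(ω̂)_1` of the link of `z`, as a distribution on vertices. -/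
def linkVertex (K : WComplex V n) (z : Finset V) : V → ℝ :=
  fun x => K.linkLevel z 1 {x}

/-- The link random-walk matrix `M_ω̂` of a face `z` (with `|z| ≤ n-2`). -/
def linkMat (K : WComplex V n) (z : Finset V) : V → V → ℝ :=
  fun x y =>
    if x ≠ y then (K.mass (z ∪ {x, y}) / K.mass (z ∪ {x})) / ((n : ℝ) - z.card - 1)
    else 0

/-- The local `Φ`-entropy contraction constant `lc_Φ(ω̂)`: the smallest `c ≥ 0` with
`Ent^Φ_{π^(ω̂)_1}(Up^{ω̂}_{1→n'} g) ≤ c·Ent^Φ_{π^(ω̂)_{n'}}(g)` for all `g ≥ 0`,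
where `n' = n - |ω̂|`. -/
def lcPhi (K : WComplex V n) (Φ : ℝ → ℝ) (z : Finset V) : ℝ :=
  sInf {c | 0 ≤ c ∧ ∀ g : Finset V → ℝ, (∀ x, 0 ≤ g x) →
      phiEnt Φ (K.linkLevel z 1) (mApp (K.linkUp z 1 (n - z.card)) g)
        ≤ c * phiEnt Φ (K.linkLevel z (n - z.card)) g}

/-- The local entropy contraction constant `lec(ω̂)` (the case `Φ(t) = t log t`). -/
def lec (K : WComplex V n) (z : Finset V) : ℝ := K.lcPhi nlog z

end WComplex

/-! ## Partite complexes, auxiliary expander graphs, and expanderized walks -/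

section Partite

variable {n : ℕ} {U : Type*} [Fintype U] [DecidableEq U]

/-- The type of a face of an `n`-partite complex: the set of sides it meets. -/
def typ (α : Finset (Fin n × U)) : Finset (Fin n) := α.image Prod.fst

/-- The restriction `ω_S` of a face to the sides in `S`. -/
def restrict (ω : Finset (Fin n × U)) (S : Finset (Fin n)) : Finset (Fin n × U) :=
  ω.filter fun v => v.1 ∈ S

/-- An `n`-partite complex: every facet contains exactly one vertex from each side. -/
def IsPartite (K : WComplex (Fin n × U) n) : Prop :=
  ∀ ω ∈ K.faces, ω.card = n → (typ ω).card = n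

/-- `H` is a `k`-regular graph all of whose edges join `ℓ`-element subsets of `[n]`. -/
def IsRegularOnSubsets (H : SimpleGraph (Finset (Fin n))) (ℓ k : ℕ) : Prop :=
  (∀ S T, H.Adj S T → S.card = ℓ ∧ T.card = ℓ) ∧
  (∀ S : Finset (Fin n), S.card = ℓ → (Finset.univ.filter fun T => H.Adj S T).card = k)

/-- The simple random walk matrix of a `k`-regular graph `H`. -/
def walkMat (H : SimpleGraph (Finset (Fin n))) (k : ℕ) :
    Finset (Fin n) → Finset (Fin n) → ℝ :=
  fun S T => if H.Adj S T then (k : ℝ)⁻¹ else 0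

/-- The uniform distribution on `ℓ`-element subsets of `[n]`. -/
def unifSubsets (n ℓ : ℕ) : Finset (Fin n) → ℝ :=
  fun S => if S.card = ℓ then ((n.choose ℓ : ℝ))⁻¹ else 0

/-- The two-sided expansion `λ(H)` of `H`. -/
def lamH (H : SimpleGraph (Finset (Fin n))) (ℓ k : ℕ) : ℝ :=
  twoSided (unifSubsets n ℓ) (walkMat H k)

/-- The two-sided expansion `λ(H²)` of the square of `H` (i.e. of the graph whose
random walk matrix is the square of that of `H`). -/
def lamHsq (H : SimpleGraph (Finset (Fin n))) (ℓ k : ℕ) : ℝ :=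
  twoSided (unifSubsets n ℓ) (matMul (walkMat H k) (walkMat H k))

/-- `Pr_{ω∼π}[ω_{typ a} = a ∧ ω_{typ b} = b]`. -/
def jointMass (K : WComplex (Fin n × U) n) (a b : Finset (Fin n × U)) : ℝ :=
  ∑ ω : Finset (Fin n × U),
    if restrict ω (typ a) = a ∧ restrict ω (typ b) = b then K.pi ω else 0

/-- The expanderized up-down walk with type-transition matrix `W`; taking
`W = walkMat H k` gives `UpDown(X, π, H)`, and taking `W = (walkMat H k)²`
gives `UpDown(X, π, H²)`.  Its `(ω̂, ω̃)` entry is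
`W(typ ω̂, typ ω̃) · Pr_{ω∼π}[ω_{typ ω̃} = ω̃ ∣ ω_{typ ω̂} = ω̂]`. -/
def expUpDown (K : WComplex (Fin n × U) n)
    (W : Finset (Fin n) → Finset (Fin n) → ℝ) :
    Finset (Fin n × U) → Finset (Fin n × U) → ℝ :=
  fun a b => W (typ a) (typ b) * (jointMass K a b / jointMass K a a)

/-- The expanderized down-walk `Qdo` from `X^(n) × binom([n],ℓ)` to `X^(ℓ)`. -/
def Qdown (K : WComplex (Fin n × U) n) (H : SimpleGraph (Finset (Fin n))) (k : ℕ) :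
    Finset (Fin n × U) × Finset (Fin n) → Finset (Fin n × U) → ℝ :=
  fun p b => if H.Adj p.2 (typ b) ∧ b ⊆ p.1 then (k : ℝ)⁻¹ else 0

/-- The expanderized up-walk `Qup` from `X^(ℓ)` to `X^(n) × binom([n],ℓ)`
(the adjoint of `Qdown` with respect to `(π_n ⊗ Unif, π_ℓ)`). -/
def Qup (K : WComplex (Fin n × U) n) (H : SimpleGraph (Finset (Fin n))) (k : ℕ) :
    Finset (Fin n × U) → Finset (Fin n × U) × Finset (Fin n) → ℝ :=
  fun b p =>
    (if H.Adj p.2 (typ b) then (k : ℝ)⁻¹ else 0) *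
      ((if b ⊆ p.1 then K.pi p.1 else 0) / K.mass b)

/-- The expanderized down-up walk `Paqx = Qdo·Qup` on `X^(n) × binom([n],ℓ)`. -/
def expDownUp (K : WComplex (Fin n × U) n) (H : SimpleGraph (Finset (Fin n))) (k : ℕ) :
    Finset (Fin n × U) × Finset (Fin n) → Finset (Fin n × U) × Finset (Fin n) → ℝ :=
  matMul (Qdown K H k) (Qup K H k)

/-- The product distribution `π_n ⊗ Unif_{binom([n],ℓ)}`. -/
def prodDist (K : WComplex (Fin n × U) n) (ℓ : ℕ) :
    Finset (Fin n × U) × Finset (Fin n) → ℝ :=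
  fun p => K.pi p.1 * unifSubsets n ℓ p.2

end Partite

/-! ## List colorings -/

section Coloring

variable {n : ℕ} {Col : Type*} [Fintype Col] [DecidableEq Col]

/-- The degree of a vertex in a graph. -/
def degree' {W : Type*} [Fintype W] (G : SimpleGraph W) (v : W) : ℕ :=
  (Finset.univ.filter fun u => G.Adj v u).card

/-- A proper list coloring of `(G, L)`. -/
def IsProperColoring (G : SimpleGraph (Fin n)) (L : Fin n → Finset Col)
    (c : Fin n → Col) : Prop :=
  (∀ v, c v ∈ L v) ∧ ∀ u v, G.Adj u v → c u ≠ c v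

/-- The face `{(v, c v) : v}` associated to a coloring `c`. -/
def colorFace (c : Fin n → Col) : Finset (Fin n × Col) :=
  Finset.univ.image fun v => (v, c v)

/-- `Y` is the list-coloring complex of `(G, L)`: its faces are the subsets of proper
list colorings and its weight is the uniform distribution on proper list colorings. -/
def IsColoringComplex (G : SimpleGraph (Fin n)) (L : Fin n → Finset Col)
    (Y : WComplex (Fin n × Col) n) : Prop :=
  (∀ α : Finset (Fin n × Col),
      α ∈ Y.faces ↔ ∃ c : Fin n → Col, IsProperColoring G L c ∧ α ⊆ colorFace c) ∧
  (∀ ω : Finset (Fin n × Col),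
      Y.pi ω =
        ∑ c : Fin n → Col,
          if IsProperColoring G L c ∧ ω = colorFace c then
            ((Finset.univ.filter fun c' : Fin n → Col =>
                IsProperColoring G L c').card : ℝ)⁻¹
          else 0)

end Coloring

/-! ## Ising models -/

section Ising

variable {n : ℕ}

/-- `±1` value of a Boolean spin. -/
def signR (b : Bool) : ℝ := if b then 1 else -1

/-- The (unnormalized) Ising weight `exp(½⟨x,Jx⟩ + ⟨h,x⟩)`. -/
def isingWeight (J : Matrix (Fin n) (Fin n) ℝ) (h : Fin n → ℝ) (x : Fin n → Bool) : ℝ :=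
  Real.exp ((1 / 2) * (∑ i, ∑ j, J i j * (signR (x i) * signR (x j))) +
    ∑ i, h i * signR (x i))

/-- The face `{(i, x i) : i}` associated to a spin configuration `x`. -/
def spinFace (x : Fin n → Bool) : Finset (Fin n × Bool) :=
  Finset.univ.image fun i => (i, x i)

/-- `Y` is the Ising complex of `(J, h)`. -/
def IsIsingComplex (J : Matrix (Fin n) (Fin n) ℝ) (h : Fin n → ℝ)
    (Y : WComplex (Fin n × Bool) n) : Prop :=
  (∀ α : Finset (Fin n × Bool), α ∈ Y.faces ↔ ∃ x : Fin n → Bool, α ⊆ spinFace x) ∧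
  (∀ ω : Finset (Fin n × Bool),
      Y.pi ω =
        (∑ x : Fin n → Bool, if ω = spinFace x then isingWeight J h x else 0) /
          ∑ x : Fin n → Bool, isingWeight J h x)

/-- The `ℓ₂ → ℓ₂` operator norm of a square matrix. -/
def matOpNorm {m : ℕ} (J : Matrix (Fin m) (Fin m) ℝ) : ℝ :=
  sSup {r | ∃ v : Fin m → ℝ, (∑ i, v i ^ 2) = 1 ∧
      r = Real.sqrt (∑ i, (J.mulVec v i) ^ 2)}

/-- The `2×2` principal submatrix of `J` at rows/columns `i, j`. -/
def principal2 (J : Matrix (Fin n) (Fin n) ℝ) (i j : Fin n) : Matrix (Fin 2) (Fin 2) ℝ :=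
  !![J i i, J i j; J j i, J j j]

/-- `‖h‖_∞`. -/
def normInf (h : Fin n → ℝ) : ℝ := sSup (Set.range fun i => |h i|)

/-- `‖h‖_₁`. -/
def norm1 (h : Fin n → ℝ) : ℝ := ∑ i, |h i|

end Ising

end Expanderized

namespace Expanderized

namespace WComplex

variable {V : Type*} [Fintype V] [DecidableEq V] {n : ℕ}

lemma pi_nonneg (K : WComplex V n) (ω : Finset V) : 0 ≤ K.pi ω := by
  by_cases hω : ω ∈ K.faces
  · by_cases hc : ω.card = n
    · exact (K.pi_pos ω hω hc).le
    · exact (K.pi_zero_of_card_ne ω hc).ge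
  · exact (K.pi_zero_of_not_mem ω hω).ge

lemma mass_nonneg (K : WComplex V n) (α : Finset V) : 0 ≤ K.mass α :=
  Finset.sum_nonneg fun ω _ => by
    split_ifs
    exacts [K.pi_nonneg ω, le_rfl]

lemma mass_anti (K : WComplex V n) {α β : Finset V} (h : α ⊆ β) : K.mass β ≤ K.mass α := by
  refine Finset.sum_le_sum fun ω _ => ?_
  by_cases hβ : β ⊆ ω
  · rw [if_pos hβ, if_pos (h.trans hβ)]
  · rw [if_neg hβ]
    split_ifs
    exacts [K.pi_nonneg ω, le_rfl]

/-- The mass of a face cancels against the conditional mass of a larger face, even when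
the mass vanishes. -/
lemma mass_mul_div (K : WComplex V n) {α β : Finset V} (h : α ⊆ β) :
    K.mass α * (K.mass β / K.mass α) = K.mass β :=
  mul_div_cancel_of_imp' fun h0 => le_antisymm (h0 ▸ K.mass_anti h) (K.mass_nonneg β)

/-- Summing over the sets disjoint from `z` amounts to summing over the supersets of `z`. -/
lemma sum_disjoint_union (z : Finset V) (h : Finset V → ℝ) :
    (∑ α : Finset V, if Disjoint α z then h (z ∪ α) else 0) =
      ∑ β : Finset V, if z ⊆ β then h β else 0 := by
  rw [← Finset.sum_filter, ← Finset.sum_filter]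
  refine Finset.sum_bij' (fun α _ => z ∪ α) (fun β _ => β \ z) ?_ ?_ ?_ ?_ ?_
  · intro α _
    simp
  · intro β _
    simpa using Finset.sdiff_disjoint
  · intro α hα
    exact Finset.union_sdiff_cancel_left (Finset.mem_filter.1 hα).2.symm
  · intro β hβ
    exact Finset.union_sdiff_of_subset (Finset.mem_filter.1 hβ).2
  · intro α _
    rfl

lemma linkMass_eq (K : WComplex V n) (z α : Finset V) :
    K.linkMass z α = if Disjoint α z then K.mass (z ∪ α) / K.mass z else 0 := by
  have key : K.linkMass z α = ∑ β : Finset V, if Disjoint β z then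
      (if Disjoint α z ∧ α ⊆ z ∪ β then K.pi (z ∪ β) / K.mass z else 0) else 0 := by
    refine Finset.sum_congr rfl fun β _ => ?_
    by_cases hβ : Disjoint β z
    · have hiff : α ⊆ β ↔ Disjoint α z ∧ α ⊆ z ∪ β :=
        ⟨fun h => ⟨hβ.mono_left h, h.trans Finset.subset_union_right⟩,
          fun h => h.1.left_le_of_le_sup_left h.2⟩
      simp only [linkPi, hβ, if_true, hiff]
    · simp [linkPi, hβ]
  rw [key, sum_disjoint_union z
    (fun ω => if Disjoint α z ∧ α ⊆ ω then K.pi ω / K.mass z else 0)]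
  split_ifs with hα
  · rw [show K.mass (z ∪ α) = ∑ ω : Finset V, if z ∪ α ⊆ ω then K.pi ω else 0 from rfl,
      Finset.sum_div]
    refine Finset.sum_congr rfl fun ω _ => ?_
    simp only [hα, true_and, Finset.union_subset_iff, ite_and, ite_div, zero_div]
  · simp [hα]

/-- Averaging a localization over a level of the link is the same as applying the up-walk. -/
lemma expect_linkLevel (K : WComplex V n) {ℓ r : ℕ} (hlr : ℓ ≤ r) {z : Finset V}
    (hz : z.card = ℓ) (g : Finset V → ℝ) :
    expect (K.linkLevel z (r - ℓ)) (fun α => g (z ∪ α)) = mApp (K.up ℓ r) g z := by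
  have key : expect (K.linkLevel z (r - ℓ)) (fun α => g (z ∪ α)) =
      ∑ α : Finset V, if Disjoint α z then (if (z ∪ α).card = r then
        ((n - ℓ).choose (r - ℓ) : ℝ)⁻¹ * (K.mass (z ∪ α) / K.mass z) * g (z ∪ α)
        else 0) else 0 := by
    refine Finset.sum_congr rfl fun α _ => ?_
    by_cases hα : Disjoint α z
    · have hiff : α.card = r - ℓ ↔ (z ∪ α).card = r := by
        rw [Finset.card_union_of_disjoint hα.symm]
        omega
      simp only [linkLevel, linkMass_eq, hα, if_true, hz, hiff, ite_mul, zero_mul]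
    · simp [linkLevel, linkMass_eq, hα]
  rw [key, sum_disjoint_union z (fun b => if b.card = r then
    ((n - ℓ).choose (r - ℓ) : ℝ)⁻¹ * (K.mass b / K.mass z) * g b else 0)]
  refine Finset.sum_congr rfl fun b _ => ?_
  by_cases h1 : z ⊆ b <;> by_cases h2 : b.card = r <;> simp [up, hz, h1, h2]

/-- The up-walk transports `π_ℓ` to `π_r`. -/
lemma rowMul_level_up (K : WComplex V n) {ℓ r : ℕ} (hlr : ℓ ≤ r) (hrn : r ≤ n) :
    rowMul (K.level ℓ) (K.up ℓ r) = K.level r := by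
  funext b
  by_cases hb : b.card = r
  · have hterm : ∀ z : Finset V, K.level ℓ z * K.up ℓ r z b =
        if z ∈ b.powersetCard ℓ then
          (n.choose ℓ : ℝ)⁻¹ * ((n - ℓ).choose (r - ℓ) : ℝ)⁻¹ * K.mass b else 0 := by
      intro z
      by_cases hz : z.card = ℓ
      · by_cases hzb : z ⊆ b
        · simp only [level, up, Finset.mem_powersetCard, hz, hb, hzb, and_self, if_true]
          linear_combination (n.choose ℓ : ℝ)⁻¹ * ((n - ℓ).choose (r - ℓ) : ℝ)⁻¹ *
            K.mass_mul_div hzb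
        · simp [up, Finset.mem_powersetCard, hzb]
      · simp [level, Finset.mem_powersetCard, hz]
    have hchoose : (n.choose r : ℝ) * r.choose ℓ = n.choose ℓ * (n - ℓ).choose (r - ℓ) := by
      exact_mod_cast Nat.choose_mul (n := n) hlr
    have h1 : (n.choose r : ℝ) ≠ 0 := by exact_mod_cast (Nat.choose_pos hrn).ne'
    have h2 : (n.choose ℓ : ℝ) ≠ 0 := by exact_mod_cast (Nat.choose_pos (hlr.trans hrn)).ne'
    have h3 : ((n - ℓ).choose (r - ℓ) : ℝ) ≠ 0 := by
      exact_mod_cast (Nat.choose_pos (Nat.sub_le_sub_right hrn ℓ)).ne'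
    simp only [rowMul, hterm]
    rw [level, if_pos hb, ← Finset.sum_filter, Finset.filter_mem_eq_inter, Finset.univ_inter,
      Finset.sum_const, Finset.card_powersetCard, hb, nsmul_eq_mul]
    field_simp
    linear_combination K.mass b * hchoose
  · simp [rowMul, level, up, hb]

end WComplex

lemma expect_mApp {α β : Type*} [Fintype α] [Fintype β] (μ : α → ℝ) (P : α → β → ℝ)
    (g : β → ℝ) : expect μ (mApp P g) = expect (rowMul μ P) g := by
  simp only [expect, mApp, rowMul, Finset.mul_sum, Finset.sum_mul]
  rw [Finset.sum_comm]
  simp only [mul_assoc]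

end Expanderized

open Expanderized WComplex in
/-- **Chain rule for `Φ`-entropy.** For every `f : X^(r) → ℝ≥0`,
`Ent^Φ_{π_r}(f) = E_{ω̂∼π_ℓ}[Ent^Φ_{π^(ω̂)_{r−ℓ}}(f|_ω̂)] + Ent^Φ_{π_ℓ}(Up_{ℓ→r} f)`,
where `f|_ω̂(α) = f(ω̂ ∪ α)` is the localization of `f` at `ω̂`. -/
theorem statement11 {V : Type*} [Fintype V] [DecidableEq V] {n ℓ r : ℕ}
    (K : WComplex V n) (hlr : ℓ ≤ r) (hrn : r ≤ n)
    (Φ : ℝ → ℝ) (hconv : ConvexOn ℝ (Set.Ici 0) Φ) (hpos : ∀ t, 0 ≤ t → 0 ≤ Φ t)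
    (f : Finset V → ℝ) (hf : ∀ α, 0 ≤ f α) :
    phiEnt Φ (K.level r) f =
      expect (K.level ℓ)
          (fun z => phiEnt Φ (K.linkLevel z (r - ℓ)) (fun α => f (z ∪ α))) +
        phiEnt Φ (K.level ℓ) (mApp (K.up ℓ r) f) := by
  have hlink : expect (K.level ℓ)
      (fun z => phiEnt Φ (K.linkLevel z (r - ℓ)) (fun α => f (z ∪ α))) =
        expect (K.level ℓ) (fun z =>
          mApp (K.up ℓ r) (fun α => Φ (f α)) z - Φ (mApp (K.up ℓ r) f z)) := by
    refine Finset.sum_congr rfl fun z _ => ?_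
    by_cases hz : z.card = ℓ
    · simp only [phiEnt]
      rw [K.expect_linkLevel hlr hz f, K.expect_linkLevel hlr hz (fun α => Φ (f α))]
    · simp [level, hz]
  have hsub : expect (K.level ℓ) (fun z =>
      mApp (K.up ℓ r) (fun α => Φ (f α)) z - Φ (mApp (K.up ℓ r) f z)) =
        expect (K.level ℓ) (mApp (K.up ℓ r) (fun α => Φ (f α))) -
          expect (K.level ℓ) (fun z => Φ (mApp (K.up ℓ r) f z)) := by
    simp only [expect, mul_sub, Finset.sum_sub_distrib]
  rw [hlink, hsub, phiEnt, phiEnt, expect_mApp, expect_mApp, K.rowMul_level_up hlr hrn]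
  ring
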